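/- Under the hypotheses of the regularized switching algorithm theorem (each f_i is M_i-relatively Lipschitz continuous and μ_t-relatively strongly convex w.r.t. h, g is M_g-relatively Lipschitz continuous and μ_g-relatively strongly convex w.r.t. h, d is M_d-relatively Lipschitz continuous, 1-relatively strongly convex, nonnegative on Q with A² = sup_{x∈Q} d(x), M = max of all M_i and M_g, λ_t = ½·(√((μ_{1:t} + λ_{1:t−1})² + 8·M²/(A² + 2·M_d²)) − (μ_{1:t} + λ_{1:t−1})), η_t = 1/(μ_{1:t} + λ_{1:t}), exactly T productive and T_J non-productive steps, Regret_T ≥ 0), the following bound holds: Regret_T ≤ 2·inf over all nonnegative sequences λ_1*, …, λ*_{T+T_J} of [(A² + 2·M_d²)·λ*_{1:T+T_J} + Σ_{t=1}^{T+T_J} (M + λ_t*·M_d)²/(μ_{1:t} + λ*_{1:t})] − ε·T_J. -/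

import Mathlib

open scoped RealInnerProductSpace
open Finset

/-- The Bregman divergence `V(y,x) = h(y) − h(x) − ⟨∇h(x), y − x⟩`. -/
noncomputable def breg {E : Type*} [NormedAddCommGroup E] [InnerProductSpace ℝ E]
    [CompleteSpace E] (h : E → ℝ) (y x : E) : ℝ :=
  h y - h x - ⟪gradient h x, y - x⟫

/-- `f` is `M`-relatively Lipschitz continuous w.r.t. the prox-function `h` on `Q`. -/
noncomputable def RelLipschitz {E : Type*} [NormedAddCommGroup E] [InnerProductSpace ℝ E]
    [CompleteSpace E] (h : E → ℝ) (Q : Set E) (M : ℝ) (f : E → ℝ) : Prop :=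
  ∀ x ∈ Q, ∀ y ∈ Q, 0 ≤ ⟪gradient f x, y - x⟫ + M * Real.sqrt (2 * breg h y x)

/-- `f` is `μ`-relatively strongly convex w.r.t. the prox-function `h` on `Q`. -/
noncomputable def RelStrongConvex {E : Type*} [NormedAddCommGroup E] [InnerProductSpace ℝ E]
    [CompleteSpace E] (h : E → ℝ) (Q : Set E) (μ : ℝ) (f : E → ℝ) : Prop :=
  ∀ x ∈ Q, ∀ y ∈ Q, f y + ⟪gradient f y, x - y⟫ + μ * breg h x y ≤ f x

/-- One mirror-descent step from `x` with step size `η` in the direction `v`: there is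
`y` with `∇h(y) = ∇h(x) − η·v`, and the next iterate `x'` is the Bregman projection of
`y` onto `Q`. -/
noncomputable def MDStepV {E : Type*} [NormedAddCommGroup E] [InnerProductSpace ℝ E]
    [CompleteSpace E] (h : E → ℝ) (Q : Set E) (η : ℝ) (v : E) (x x' : E) : Prop :=
  ∃ y : E, gradient h y = gradient h x - η • v ∧ x' ∈ Q ∧
    IsMinOn (fun z => breg h z y) Q x'

section Helpers

variable {E : Type*} [NormedAddCommGroup E] [InnerProductSpace ℝ E] [CompleteSpace E]

/-- Gradient inequality for a differentiable convex function. -/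
theorem aux_grad_ineq (φ : E → ℝ) (hd : Differentiable ℝ φ) (hc : ConvexOn ℝ Set.univ φ)
    (x y : E) : φ x + ⟪gradient φ x, y - x⟫ ≤ φ y := by
  have hline : HasDerivAt (fun s : ℝ => AffineMap.lineMap (k := ℝ) x y s) (y - x) 0 :=
    AffineMap.hasDerivAt_lineMap
  have hg : HasFDerivAt φ ((InnerProductSpace.toDual ℝ E) (gradient φ x)) x :=
    (hd x).hasGradientAt.hasFDerivAt
  have hg' : HasFDerivAt φ ((InnerProductSpace.toDual ℝ E) (gradient φ x))
      (AffineMap.lineMap (k := ℝ) x y (0 : ℝ)) := by simpa using hg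
  have hder := hg'.comp_hasDerivAt (0 : ℝ) hline
  have hconv : ConvexOn ℝ Set.univ (φ ∘ (AffineMap.lineMap (k := ℝ) x y)) := by
    simpa using hc.comp_affineMap (AffineMap.lineMap (k := ℝ) x y)
  have := hconv.le_slope_of_hasDerivAt (Set.mem_univ 0) (Set.mem_univ 1) one_pos hder
  rw [InnerProductSpace.toDual_apply_apply, slope_def_field] at this
  simp only [Function.comp_apply, AffineMap.lineMap_apply_zero, AffineMap.lineMap_apply_one,
    sub_zero, div_one] at this
  linarith

theorem aux_breg_nonneg (h : E → ℝ) (hd : Differentiable ℝ h) (hc : ConvexOn ℝ Set.univ h)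
    (y x : E) : 0 ≤ breg h y x := by
  have := aux_grad_ineq h hd hc x y
  unfold breg; linarith

/-- First-order optimality for the Bregman projection. -/
theorem aux_opt (h : E → ℝ) (hd : Differentiable ℝ h) (Q : Set E) (hQ : Convex ℝ Q)
    (y x' u : E) (hx' : x' ∈ Q) (hu : u ∈ Q) (hmin : IsMinOn (fun z => breg h z y) Q x') :
    0 ≤ ⟪gradient h x' - gradient h y, u - x'⟫ := by
  have hg : HasFDerivAt h ((InnerProductSpace.toDual ℝ E) (gradient h x')) x' :=
    (hd x').hasGradientAt.hasFDerivAt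
  have hl : HasFDerivAt (fun z => ⟪gradient h y, z - y⟫)
      ((InnerProductSpace.toDual ℝ E) (gradient h y)) x' := by
    have h1 := ((InnerProductSpace.toDual ℝ E) (gradient h y)).hasFDerivAt (x := x' - y)
    have h2 := h1.comp x' ((hasFDerivAt_id x').sub_const y)
    simpa [Function.comp_def] using h2
  have hb : HasFDerivAt (fun z => breg h z y)
      ((InnerProductSpace.toDual ℝ E) (gradient h x')
        - (InnerProductSpace.toDual ℝ E) (gradient h y)) x' := by
    unfold breg
    exact (hg.sub_const _).sub hl
  have := hmin.localize.hasFDerivWithinAt_nonneg hb.hasFDerivWithinAt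
    (sub_mem_posTangentConeAt_of_segment_subset (hQ.segment_subset hx' hu))
  simpa [inner_sub_left] using this

theorem aux_three (h : E → ℝ) (u x' x : E) :
    ⟪gradient h x' - gradient h x, u - x'⟫ = breg h u x - breg h u x' - breg h x' x := by
  unfold breg
  have : u - x = (u - x') + (x' - x) := by abel
  rw [this, inner_add_right, inner_sub_left]
  ring

/-- One step of mirror descent on `φ + l d`. -/
theorem aux_step (h : E → ℝ) (hd : Differentiable ℝ h) (hc : ConvexOn ℝ Set.univ h)
    (Q : Set E) (hQ : Convex ℝ Q) (φ d : E → ℝ) (M Md m l S : ℝ) (hl : 0 ≤ l) (hS : 0 < S)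
    (hφL : RelLipschitz h Q M φ) (hφS : RelStrongConvex h Q m φ)
    (hdL : RelLipschitz h Q Md d) (hdS : RelStrongConvex h Q 1 d)
    (x x' u : E) (hx : x ∈ Q) (hu : u ∈ Q)
    (hstep : MDStepV h Q (1 / S) (gradient φ x + l • gradient d x) x x') :
    φ x - φ u + S * breg h u x' - (S - m - l) * breg h u x
      ≤ l * (d u - d x) + (M + l * Md) ^ 2 / (2 * S) := by
  obtain ⟨y, hy, hx', hmin⟩ := hstep
  have h1 := aux_opt h hd Q hQ y x' u hx' hu hmin
  have h2 := aux_three h u x' x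
  have h3 := hφL x hx x' hx'
  have h4 := hdL x hx x' hx'
  have h5 := hφS u hu x hx
  have h6 := hdS u hu x hx
  have hV := aux_breg_nonneg h hd hc x' x
  set w := Real.sqrt (2 * breg h x' x) with hw
  have hw2 : w ^ 2 = 2 * breg h x' x := Real.sq_sqrt (by linarith)
  have e1 : gradient h x' - gradient h y
      = (gradient h x' - gradient h x) + (1 / S) • (gradient φ x + l • gradient d x) := by
    rw [hy]; abel
  rw [e1, inner_add_left, h2, real_inner_smul_left, inner_add_left, real_inner_smul_left] at h1
  have e2 : u - x' = (u - x) - (x' - x) := by abel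
  rw [e2, inner_sub_right _ (u - x) (x' - x), inner_sub_right _ (u - x) (x' - x)] at h1
  set p1 := ⟪gradient φ x, u - x⟫
  set p2 := ⟪gradient φ x, x' - x⟫
  set q1 := ⟪gradient d x, u - x⟫
  set q2 := ⟪gradient d x, x' - x⟫
  have h1' : 0 ≤ S * (breg h u x - breg h u x' - breg h x' x) + (p1 - p2 + l * (q1 - q2)) := by
    have := mul_nonneg hS.le h1
    rw [mul_add, ← mul_assoc, mul_one_div_cancel hS.ne', one_mul] at this
    exact this
  have h4' : 0 ≤ l * (q2 + Md * w) := mul_nonneg hl h4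
  have h6' : 0 ≤ l * (d u - (d x + q1 + 1 * breg h u x)) := mul_nonneg hl (by linarith)
  have hq : (M + l * Md) * w - S * (w ^ 2 / 2) ≤ (M + l * Md) ^ 2 / (2 * S) := by
    rw [le_div_iff₀ (by positivity)]
    nlinarith [sq_nonneg (M + l * Md - S * w)]
  rw [hw2] at hq
  nlinarith

/-- `d` varies by at most `Md ^ 2 / 2` on `Q`. -/
theorem aux_d_osc (h : E → ℝ) (hd : Differentiable ℝ h) (hc : ConvexOn ℝ Set.univ h)
    (Q : Set E) (d : E → ℝ) (Md : ℝ)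
    (hdL : RelLipschitz h Q Md d) (hdS : RelStrongConvex h Q 1 d)
    (x y : E) (hx : x ∈ Q) (hy : y ∈ Q) : d x - d y ≤ Md ^ 2 / 2 := by
  have h1 := hdL x hx y hy
  have h2 := hdS y hy x hx
  have hV := aux_breg_nonneg h hd hc y x
  have hw2 : Real.sqrt (2 * breg h y x) ^ 2 = 2 * breg h y x := Real.sq_sqrt (by linarith)
  nlinarith [sq_nonneg (Md - Real.sqrt (2 * breg h y x))]

/-- the Bregman diameter of `Q` is at most `5 / 2 * Md`. -/
theorem aux_diam (h : E → ℝ) (hd : Differentiable ℝ h) (hc : ConvexOn ℝ Set.univ h)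
    (Q : Set E) (d : E → ℝ) (Md : ℝ) (hMd : 0 ≤ Md)
    (hdL : RelLipschitz h Q Md d) (hdS : RelStrongConvex h Q 1 d)
    (x y : E) (hx : x ∈ Q) (hy : y ∈ Q) : Real.sqrt (2 * breg h y x) ≤ 5 / 2 * Md := by
  have h0 := aux_d_osc h hd hc Q d Md hdL hdS y x hy hx
  have h1 := hdL x hx y hy
  have h2 := hdS y hy x hx
  have hV := aux_breg_nonneg h hd hc y x
  have hw2 : Real.sqrt (2 * breg h y x) ^ 2 = 2 * breg h y x := Real.sq_sqrt (by linarith)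
  have hw0 := Real.sqrt_nonneg (2 * breg h y x)
  by_contra hcon
  push Not at hcon
  nlinarith

end Helpers

/-- Scalar estimate of the one-step cost. -/
theorem aux_scalar (R M Md C l S W : ℝ) (hM : 0 < M) (hMd : 0 < Md) (hC : 2 * Md ^ 2 ≤ C)
    (hl : 0 ≤ l) (hS : 0 < S) (hlS : C * (l * S) = 2 * M ^ 2)
    (h1 : R ≤ l * (Md ^ 2 / 2) + (M + l * Md) ^ 2 / (2 * S))
    (hW0 : 0 ≤ W) (hW : W ≤ 5 / 2 * Md)
    (h2 : R ≤ M * W + S * (W ^ 2 / 2)) :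
    R ≤ C * (2 * l) ∧ R ≤ C * (l + l ^ 2 / S) := by
  have hCpos : 0 < C := by nlinarith
  have hCl : 0 ≤ C * l := by positivity
  have hk : (M + l * Md) ^ 2 / (2 * S) ≤ C * l / 2 + C * (l ^ 2 / S) / 2 := by
    have e : C * l / 2 + C * (l ^ 2 / S) / 2 = (C * (l * S) + C * l ^ 2) / (2 * S) := by
      field_simp
    rw [e, hlS]
    apply div_le_div_of_nonneg_right _ (by positivity)
    nlinarith [sq_nonneg (M - l * Md), mul_le_mul_of_nonneg_right hC (sq_nonneg l)]
  have hD : l * (Md ^ 2 / 2) ≤ C * l / 4 := by nlinarith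
  have hr : 0 ≤ C * (l ^ 2 / S) := by positivity
  have hA : R ≤ C * (l + l ^ 2 / S) := by nlinarith
  refine ⟨?_, hA⟩
  by_cases hρ : l ≤ 5 / 2 * S
  · have : l ^ 2 / S ≤ 5 / 2 * l := by
      rw [div_le_iff₀ hS]; nlinarith
    have := mul_le_mul_of_nonneg_left this hCpos.le
    nlinarith
  · push Not at hρ
    have hMMd : M * Md ≤ 2 / 5 * (C * l) := by
      have h3 : (M * Md) ^ 2 ≤ (2 / 5 * (C * l)) ^ 2 := by
        have : M ^ 2 * (4 * Md ^ 2) ≤ (C * (l * S) / 2) * (2 * C) := by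
          apply mul_le_mul <;> nlinarith
        have h5 : C ^ 2 * (l * S) ≤ C ^ 2 * (l * (2 / 5 * l)) := by
          have : l * S ≤ l * (2 / 5 * l) := mul_le_mul_of_nonneg_left (by linarith) hl
          exact mul_le_mul_of_nonneg_left this (sq_nonneg C)
        nlinarith [sq_nonneg (C * l)]
      exact le_of_sq_le_sq h3 (by positivity)
    have hMW : M * W ≤ M * (5 / 2 * Md) := mul_le_mul_of_nonneg_left hW hM.le
    have hW2 : W ^ 2 ≤ (5 / 2 * Md) ^ 2 := by gcongr
    have hSW : S * (W ^ 2 / 2) ≤ (2 / 5 * l) * ((25 / 8) * (C / 2)) := by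
      apply mul_le_mul <;> nlinarith
    nlinarith

/-- Comparison of the greedy coefficients with any other coefficients. -/
theorem aux_compare (N : ℕ) (μ l ls a : ℕ → ℝ) (p : ℝ) (hp : 0 ≤ p)
    (hl : ∀ t ∈ Finset.Icc 1 N, 0 ≤ l t) (hls : ∀ t ∈ Finset.Icc 1 N, 0 ≤ ls t)
    (hS : ∀ t ∈ Finset.Icc 1 N, 0 < (∑ s ∈ Finset.Icc 1 t, μ s) + ∑ s ∈ Finset.Icc 1 t, l s)
    (hSs : ∀ t ∈ Finset.Icc 1 N, 0 < (∑ s ∈ Finset.Icc 1 t, μ s) + ∑ s ∈ Finset.Icc 1 t, ls s)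
    (hlS : ∀ t ∈ Finset.Icc 1 N,
      l t * ((∑ s ∈ Finset.Icc 1 t, μ s) + ∑ s ∈ Finset.Icc 1 t, l s) = p)
    (ha1 : ∀ t ∈ Finset.Icc 1 N, a t ≤ 2 * l t)
    (ha2 : ∀ t ∈ Finset.Icc 1 N, a t ≤ l t + l t ^ 2 /
      ((∑ s ∈ Finset.Icc 1 t, μ s) + ∑ s ∈ Finset.Icc 1 t, l s)) :
    ∀ n ≤ N, (∑ t ∈ Finset.Icc 1 n, a t ≤ 2 * (∑ t ∈ Finset.Icc 1 n, l t) +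
        ∑ t ∈ Finset.Icc 1 n, p / ((∑ s ∈ Finset.Icc 1 t, μ s) + ∑ s ∈ Finset.Icc 1 t, ls s)) ∧
      (∑ t ∈ Finset.Icc 1 n, a t ≤ 2 * (∑ t ∈ Finset.Icc 1 n, ls t) +
        ∑ t ∈ Finset.Icc 1 n, p / ((∑ s ∈ Finset.Icc 1 t, μ s) + ∑ s ∈ Finset.Icc 1 t, ls s)) := by
  intro n
  induction n with
  | zero => intro _; simp
  | succ n ih =>
    intro hn
    obtain ⟨ihB, ihA⟩ := ih (by omega)
    have hm : n + 1 ∈ Finset.Icc 1 N := by simp; omega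
    have k1 := hl _ hm
    have k2 := hls _ hm
    have k3 := hS _ hm
    have k4 := hSs _ hm
    have k5 := hlS _ hm
    have k6 := ha1 _ hm
    have k7 := ha2 _ hm
    have q : ∀ F : ℕ → ℝ, ∑ t ∈ Finset.Icc 1 (n + 1), F t
        = ∑ t ∈ Finset.Icc 1 n, F t + F (n + 1) := fun F =>
      Finset.sum_Icc_succ_top (by omega) F
    rw [q a, q (fun t => p / ((∑ s ∈ Finset.Icc 1 t, μ s) + ∑ s ∈ Finset.Icc 1 t, ls s))]
    have eL := q l
    have eLs := q ls
    set m := ∑ s ∈ Finset.Icc 1 (n + 1), μ s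
    set L := ∑ s ∈ Finset.Icc 1 (n + 1), l s
    set Ls := ∑ s ∈ Finset.Icc 1 (n + 1), ls s
    set L0 := ∑ s ∈ Finset.Icc 1 n, l s
    set Ls0 := ∑ s ∈ Finset.Icc 1 n, ls s
    set P0 := ∑ t ∈ Finset.Icc 1 n,
      p / ((∑ s ∈ Finset.Icc 1 t, μ s) + ∑ s ∈ Finset.Icc 1 t, ls s)
    set A0 := ∑ t ∈ Finset.Icc 1 n, a t
    set α := a (n + 1)
    set la := l (n + 1)
    set lb := ls (n + 1)
    have hP : 0 ≤ p / (m + Ls) := by positivity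
    have hB : A0 + α ≤ 2 * L + (P0 + p / (m + Ls)) := by linarith
    refine ⟨hB, ?_⟩
    by_cases hδ : L ≤ Ls
    · linarith
    push Not at hδ
    set S := m + L with hSdef
    set δ := L - Ls with hδdef
    have hδ0 : 0 < δ := by linarith
    -- tangent bound
    have hT : la + la * δ / S ≤ p / (m + Ls) := by
      rw [le_div_iff₀ k4, ← k5]
      have e : m + Ls = S - δ := by rw [hSdef, hδdef]; ring
      rw [e]
      have : (la + la * δ / S) * (S - δ) = la * S - la * δ ^ 2 / S := by
        field_simp; ring
      rw [this]
      have : 0 ≤ la * δ ^ 2 / S := by positivity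
      linarith
    by_cases hδl : la ≤ δ
    · have : la ^ 2 / S ≤ la * δ / S := by
        apply div_le_div_of_nonneg_right _ k3.le
        nlinarith
      linarith
    · push Not at hδl
      have hla : 0 < la := by linarith
      -- interpolate
      have key : α ≤ 2 * la - 2 * δ + (la + la * δ / S) := by
        have z1 : (1 - δ / la) * α ≤ (1 - δ / la) * (2 * la) := by
          apply mul_le_mul_of_nonneg_left k6
          rw [sub_nonneg, div_le_one hla]; exact hδl.le
        have z2 : (δ / la) * α ≤ (δ / la) * (la + la ^ 2 / S) :=
          mul_le_mul_of_nonneg_left k7 (by positivity)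
        have z3 : (1 - δ / la) * (2 * la) = 2 * la - 2 * δ := by field_simp
        have z4 : (δ / la) * (la + la ^ 2 / S) = δ + la * δ / S := by field_simp
        nlinarith
      linarith

/-- Theorem 5, second bound: under the hypotheses of the regularized switching
Mirror Descent theorem,
`Regret_T ≤ 2·inf_{λ* ≥ 0} [(A² + 2·M_d²)·λ*_{1:T+T_J} + Σ_t (M + λ_t*·M_d)²/(μ_{1:t} + λ*_{1:t})] − ε·T_J`,
stated as the bound holding for every admissible nonnegative comparison sequence `λ*`. -/
theorem regularized_switching_regret_inf
    {E : Type*} [NormedAddCommGroup E] [InnerProductSpace ℝ E] [FiniteDimensional ℝ E]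
    (Q : Set E) (hQne : Q.Nonempty) (hQclosed : IsClosed Q) (hQconv : Convex ℝ Q)
    (h : E → ℝ) (hdiff : Differentiable ℝ h) (hconv : ConvexOn ℝ Set.univ h)
    (T TJ : ℕ) (hT : 0 < T)
    (f : Fin T → E → ℝ) (g : E → ℝ)
    (hfdiff : ∀ i, Differentiable ℝ (f i)) (hgdiff : Differentiable ℝ g)
    (hfconv : ∀ i, ConvexOn ℝ Set.univ (f i)) (hgconv : ConvexOn ℝ Set.univ g)
    (Mi : Fin T → ℝ) (Mg μg : ℝ) (μ : ℕ → ℝ)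
    (hfLip : ∀ i, RelLipschitz h Q (Mi i) (f i)) (hgLip : RelLipschitz h Q Mg g)
    (hgSC : RelStrongConvex h Q μg g)
    (M : ℝ) (hM : M = max (⨆ i, Mi i) Mg)
    -- the regularizer d:
    (d : E → ℝ) (hddiff : Differentiable ℝ d) (hdconv : ConvexOn ℝ Set.univ d)
    (Md A2 : ℝ)
    (hdLip : RelLipschitz h Q Md d) (hdSC : RelStrongConvex h Q 1 d)
    (hdnn : ∀ z ∈ Q, 0 ≤ d z) (hA2 : IsLUB (d '' Q) A2)
    -- the regularization coefficients and step sizes: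
    (lam : ℕ → ℝ)
    (hpos : ∀ t ∈ Finset.Icc 1 (T + TJ),
      0 < (∑ s ∈ Finset.Icc 1 t, μ s) + ∑ s ∈ Finset.Icc 1 t, lam s)
    (ε : ℝ) (hlam : ∀ t ∈ Finset.Icc 1 (T + TJ), lam t =
      (Real.sqrt (((∑ s ∈ Finset.Icc 1 t, μ s) + ∑ s ∈ Finset.Icc 1 (t - 1), lam s) ^ 2
          + 8 * M ^ 2 / (A2 + 2 * Md ^ 2))
        - ((∑ s ∈ Finset.Icc 1 t, μ s) + ∑ s ∈ Finset.Icc 1 (t - 1), lam s)) / 2)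
    (hε : 0 < ε)
    -- the iterates and the run of the regularized switching algorithm:
    (x : ℕ → E) (hx1 : x 1 ∈ Q)
    (σ : Fin T → ℕ) (hσmono : StrictMono σ)
    (hσrange : ∀ i, σ i ∈ Finset.Icc 1 (T + TJ))
    (hproductive : ∀ t ∈ Finset.Icc 1 (T + TJ), (g (x t) ≤ ε ↔ ∃ i, σ i = t))
    -- at the `i`-th productive step, `f i` is `μ_{σ i}`-relatively strongly convex:
    (hfSC : ∀ i, RelStrongConvex h Q (μ (σ i)) (f i))
    -- at non-productive steps, `μ_t = μ_g`:
    (hμg : ∀ t ∈ Finset.Icc 1 (T + TJ), (¬ ∃ i, σ i = t) → μ t = μg)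
    (hstepP : ∀ i : Fin T,
      MDStepV h Q (1 / ((∑ s ∈ Finset.Icc 1 (σ i), μ s) + ∑ s ∈ Finset.Icc 1 (σ i), lam s))
        (gradient (f i) (x (σ i)) + lam (σ i) • gradient d (x (σ i)))
        (x (σ i)) (x (σ i + 1)))
    (hstepN : ∀ t ∈ Finset.Icc 1 (T + TJ), (¬ ∃ i, σ i = t) →
      MDStepV h Q (1 / ((∑ s ∈ Finset.Icc 1 t, μ s) + ∑ s ∈ Finset.Icc 1 t, lam s))
        (gradient g (x t) + lam t • gradient d (x t)) (x t) (x (t + 1)))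
    -- the constrained minimizer x*:
    (xs : E) (hxsQ : xs ∈ Q) (hxsg : g xs ≤ 0)
    (hxsmin : ∀ y ∈ Q, g y ≤ 0 → ∑ i, f i xs ≤ ∑ i, f i y)
    -- nonnegative regret:
    (hReg : 0 ≤ ∑ i, f i (x (σ i)) - ∑ i, f i xs) :

    ∀ lamStar : ℕ → ℝ,
      (∀ t ∈ Finset.Icc 1 (T + TJ), 0 ≤ lamStar t) →
      (∀ t ∈ Finset.Icc 1 (T + TJ),
        0 < (∑ s ∈ Finset.Icc 1 t, μ s) + ∑ s ∈ Finset.Icc 1 t, lamStar s) →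
      ∑ i, f i (x (σ i)) - ∑ i, f i xs ≤
        2 * ((A2 + 2 * Md ^ 2) * (∑ s ∈ Finset.Icc 1 (T + TJ), lamStar s) +
          ∑ t ∈ Finset.Icc 1 (T + TJ), (M + lamStar t * Md) ^ 2 /
            ((∑ s ∈ Finset.Icc 1 t, μ s) + ∑ s ∈ Finset.Icc 1 t, lamStar s)) - ε * TJ := by
  intro ls hls hSs
  have hA0 : 0 ≤ A2 := le_trans (hdnn xs hxsQ) (hA2.1 ⟨xs, hxsQ, rfl⟩)
  have hC0 : 0 ≤ A2 + 2 * Md ^ 2 := by positivity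
  have hMi : ∀ i, Mi i ≤ M := fun i => by
    rw [hM]
    exact le_max_of_le_left (le_ciSup (Set.finite_range Mi).bddAbove i)
  have hMg : Mg ≤ M := by rw [hM]; exact le_max_right _ _
  obtain ⟨φ, hφf, hφg⟩ : ∃ φ : ℕ → E → ℝ, (∀ i, φ (σ i) = f i) ∧
      (∀ t, (¬ ∃ i, σ i = t) → φ t = g) :=
    ⟨Function.extend σ f (fun _ => g), fun i => hσmono.injective.extend_apply _ _ _,
      fun t ht => Function.extend_apply' _ _ _ ht⟩
  have hV := aux_breg_nonneg h hdiff hconv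
  have hLmono : ∀ (K : ℝ) (ψ : E → ℝ), K ≤ M → RelLipschitz h Q K ψ → RelLipschitz h Q M ψ := by
    intro K ψ hK hψ a ha b hb
    have h1 := hψ a ha b hb
    have h2 := mul_le_mul_of_nonneg_right hK (Real.sqrt_nonneg (2 * breg h b a))
    linarith
  have hφL : ∀ t, RelLipschitz h Q M (φ t) := by
    intro t
    by_cases ht : ∃ i, σ i = t
    · obtain ⟨i, rfl⟩ := ht
      rw [hφf]; exact hLmono _ _ (hMi i) (hfLip i)
    · rw [hφg t ht]; exact hLmono _ _ hMg hgLip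
  have hφgrad : ∀ t, ∀ a b : E, φ t a + ⟪gradient (φ t) a, b - a⟫ ≤ φ t b := by
    intro t
    by_cases ht : ∃ i, σ i = t
    · obtain ⟨i, rfl⟩ := ht
      rw [hφf]; exact aux_grad_ineq _ (hfdiff i) (hfconv i)
    · rw [hφg t ht]; exact aux_grad_ineq _ hgdiff hgconv
  have hφS : ∀ t ∈ Finset.Icc 1 (T + TJ), RelStrongConvex h Q (μ t) (φ t) := by
    intro t htm
    by_cases ht : ∃ i, σ i = t
    · obtain ⟨i, rfl⟩ := ht
      rw [hφf]; exact hfSC i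
    · rw [hφg t ht, hμg t htm ht]; exact hgSC
  have hstep : ∀ t ∈ Finset.Icc 1 (T + TJ),
      MDStepV h Q (1 / ((∑ s ∈ Finset.Icc 1 t, μ s) + ∑ s ∈ Finset.Icc 1 t, lam s))
        (gradient (φ t) (x t) + lam t • gradient d (x t)) (x t) (x (t + 1)) := by
    intro t htm
    by_cases ht : ∃ i, σ i = t
    · obtain ⟨i, rfl⟩ := ht
      rw [hφf]; exact hstepP i
    · rw [hφg t ht]; exact hstepN t htm ht
  have hxQ' : ∀ t, t ≤ T + TJ → x (t + 1) ∈ Q := by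
    intro t ht
    rcases Nat.eq_zero_or_pos t with rfl | h0
    · exact hx1
    · obtain ⟨y, -, hy, -⟩ := hstep t (by simp; omega)
      exact hy
  have hxQ : ∀ t ∈ Finset.Icc 1 (T + TJ), x t ∈ Q := by
    intro t ht
    rw [Finset.mem_Icc] at ht
    have := hxQ' (t - 1) (by omega)
    rwa [Nat.sub_add_cancel ht.1] at this
  -- the regret plus the price of the non-productive steps
  have hregret : (∑ i, f i (x (σ i)) - ∑ i, f i xs) + ε * TJ
      ≤ ∑ t ∈ Finset.Icc 1 (T + TJ), (φ t (x t) - φ t xs) := by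
    classical
    have hsub : Finset.univ.image σ ⊆ Finset.Icc 1 (T + TJ) := by
      intro t ht
      obtain ⟨i, -, rfl⟩ := Finset.mem_image.1 ht
      exact hσrange i
    rw [← Finset.sum_sdiff hsub, Finset.sum_image (fun a _ b _ hab => hσmono.injective hab),
      ← Finset.sum_sub_distrib]
    have hcard : (Finset.Icc 1 (T + TJ) \ Finset.univ.image σ).card = TJ := by
      rw [Finset.card_sdiff_of_subset hsub, Finset.card_image_of_injective _ hσmono.injective]
      simp
    have h1 := Finset.card_nsmul_le_sum (Finset.Icc 1 (T + TJ) \ Finset.univ.image σ)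
      (fun t => φ t (x t) - φ t xs) ε (by
        intro t ht
        rw [Finset.mem_sdiff, Finset.mem_image] at ht
        have hne : ¬ ∃ i, σ i = t := fun ⟨i, hi⟩ => ht.2 ⟨i, Finset.mem_univ _, hi⟩
        have hgt : ε < g (x t) := by
          by_contra hc
          exact hne ((hproductive t ht.1).1 (not_lt.1 hc))
        simp only [hφg t hne]
        linarith)
    rw [hcard, nsmul_eq_mul] at h1
    simp only [hφf]
    linarith
  -- nonnegativity of the right-hand side bracket
  have hΛ0 : 0 ≤ ∑ s ∈ Finset.Icc 1 (T + TJ), ls s := Finset.sum_nonneg hls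
  have hbr : 0 ≤ (A2 + 2 * Md ^ 2) * (∑ s ∈ Finset.Icc 1 (T + TJ), ls s) +
      ∑ t ∈ Finset.Icc 1 (T + TJ), (M + ls t * Md) ^ 2 /
        ((∑ s ∈ Finset.Icc 1 t, μ s) + ∑ s ∈ Finset.Icc 1 t, ls s) :=
    add_nonneg (mul_nonneg hC0 hΛ0)
      (Finset.sum_nonneg fun t ht => div_nonneg (sq_nonneg _) (hSs t ht).le)
  -- degenerate situation: all losses are constant on `Q`
  have hdeg : (∀ t, ∀ a ∈ Q, ∀ b ∈ Q, 0 ≤ ⟪gradient (φ t) a, b - a⟫) →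
      ∑ i, f i (x (σ i)) - ∑ i, f i xs ≤
        2 * ((A2 + 2 * Md ^ 2) * (∑ s ∈ Finset.Icc 1 (T + TJ), ls s) +
          ∑ t ∈ Finset.Icc 1 (T + TJ), (M + ls t * Md) ^ 2 /
            ((∑ s ∈ Finset.Icc 1 t, μ s) + ∑ s ∈ Finset.Icc 1 t, ls s)) - ε * TJ := by
    intro hz
    have : ∑ t ∈ Finset.Icc 1 (T + TJ), (φ t (x t) - φ t xs) ≤ 0 := by
      apply Finset.sum_nonpos
      intro t ht
      have h1 := hz t (x t) (hxQ t ht) xs hxsQ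
      have h2 := hφgrad t (x t) xs
      linarith
    linarith
  rcases le_or_gt M 0 with hM0 | hM0
  · apply hdeg
    intro t a ha b hb
    have h1 := hφL t a ha b hb
    have h2 := mul_nonpos_of_nonpos_of_nonneg hM0 (Real.sqrt_nonneg (2 * breg h b a))
    linarith
  rcases le_or_gt Md 0 with hMd0 | hMd0
  · apply hdeg
    have hdg : ∀ a ∈ Q, ∀ b ∈ Q, 0 ≤ ⟪gradient d a, b - a⟫ := by
      intro a ha b hb
      have h1 := hdLip a ha b hb
      have h2 := mul_nonpos_of_nonpos_of_nonneg hMd0 (Real.sqrt_nonneg (2 * breg h b a))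
      linarith
    have hV0 : ∀ a ∈ Q, ∀ b ∈ Q, breg h b a = 0 := by
      intro a ha b hb
      have h1 := hdg a ha b hb
      have h2 := hdg b hb a ha
      have h3 := hdSC a ha b hb
      have h4 := hdSC b hb a ha
      have h5 := hV a b
      have h6 := hV b a
      linarith
    intro t a ha b hb
    have h1 := hφL t a ha b hb
    rw [hV0 a ha b hb] at h1
    simpa using h1
  -- main case
  set C := A2 + 2 * Md ^ 2 with hCdef
  have hCpos : 0 < C := by positivity
  have hC2 : 2 * Md ^ 2 ≤ C := by linarith
  have hSsucc : ∀ t ∈ Finset.Icc 1 (T + TJ),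
      (∑ s ∈ Finset.Icc 1 t, lam s) = (∑ s ∈ Finset.Icc 1 (t - 1), lam s) + lam t ∧
      (∑ s ∈ Finset.Icc 1 t, μ s) = (∑ s ∈ Finset.Icc 1 (t - 1), μ s) + μ t := by
    intro t ht
    rw [Finset.mem_Icc] at ht
    obtain ⟨k, rfl⟩ : ∃ k, t = k + 1 := ⟨t - 1, by omega⟩
    exact ⟨Finset.sum_Icc_succ_top (by omega) lam, Finset.sum_Icc_succ_top (by omega) μ⟩
  have hlam0 : ∀ t ∈ Finset.Icc 1 (T + TJ), 0 ≤ lam t := by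
    intro t ht
    rw [hlam t ht]
    have := Real.le_sqrt_of_sq_le (le_add_of_nonneg_right
      (a := ((∑ s ∈ Finset.Icc 1 t, μ s) + ∑ s ∈ Finset.Icc 1 (t - 1), lam s) ^ 2)
      (b := 8 * M ^ 2 / C) (by positivity))
    linarith
  have hlamS : ∀ t ∈ Finset.Icc 1 (T + TJ),
      lam t * ((∑ s ∈ Finset.Icc 1 t, μ s) + ∑ s ∈ Finset.Icc 1 t, lam s) = 2 * M ^ 2 / C := by
    intro t ht
    rw [(hSsucc t ht).1, ← add_assoc]
    have e := hlam t ht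
    set b := (∑ s ∈ Finset.Icc 1 t, μ s) + ∑ s ∈ Finset.Icc 1 (t - 1), lam s
    have hsq := Real.sq_sqrt (show 0 ≤ b ^ 2 + 8 * M ^ 2 / C by positivity)
    set r := Real.sqrt (b ^ 2 + 8 * M ^ 2 / C)
    rw [e]
    have : 8 * M ^ 2 / C = 4 * (2 * M ^ 2 / C) := by ring
    linarith
  -- the one-step cost
  set S : ℕ → ℝ := fun t => (∑ s ∈ Finset.Icc 1 t, μ s) + ∑ s ∈ Finset.Icc 1 t, lam s with hSdef
  set R : ℕ → ℝ := fun t => φ t (x t) - φ t xs + S t * breg h xs (x (t + 1))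
    - S (t - 1) * breg h xs (x t) with hRdef
  have hR : ∀ t ∈ Finset.Icc 1 (T + TJ),
      R t ≤ C * (2 * lam t) ∧ R t ≤ C * (lam t + lam t ^ 2 / S t) := by
    intro t ht
    have ht' := Finset.mem_Icc.1 ht
    have hSt : 0 < S t := hpos t ht
    have hSprev : S t - μ t - lam t = S (t - 1) := by
      have := hSsucc t ht
      simp only [hSdef]
      linarith
    have hSp0 : 0 ≤ S (t - 1) := by
      rcases Nat.eq_zero_or_pos (t - 1) with h0 | h0
      · rw [h0]; simp [hSdef]
      · exact (hpos (t - 1) (by simp; omega)).le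
    have hq := hxQ t ht
    have hq' := hxQ' t ht'.2
    have b1 := aux_step h hdiff hconv Q hQconv (φ t) d M Md (μ t) (lam t) (S t) (hlam0 t ht) hSt
      (hφL t) (hφS t ht) hdLip hdSC (x t) (x (t + 1)) xs hq hxsQ (hstep t ht)
    rw [hSprev] at b1
    have b2 := mul_le_mul_of_nonneg_left
      (aux_d_osc h hdiff hconv Q d Md hdLip hdSC xs (x t) hxsQ hq) (hlam0 t ht)
    have w1 := aux_diam h hdiff hconv Q d Md hMd0.le hdLip hdSC (x t) xs hq hxsQ
    have w2 := aux_diam h hdiff hconv Q d Md hMd0.le hdLip hdSC (x (t + 1)) xs hq' hxsQ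
    have s2 := Real.sq_sqrt (show 0 ≤ 2 * breg h xs (x (t + 1)) by linarith [hV xs (x (t + 1))])
    have l1 := hφL t (x t) hq xs hxsQ
    have l2 := hφgrad t (x t) xs
    have hW2 : Real.sqrt (2 * breg h xs (x (t + 1))) ^ 2 ≤ (5 / 2 * Md) ^ 2 :=
      pow_le_pow_left₀ (Real.sqrt_nonneg _) w2 2
    have m1 := mul_le_mul_of_nonneg_left w1 hM0.le
    have m2 : S t * breg h xs (x (t + 1)) ≤ S t * ((5 / 2 * Md) ^ 2 / 2) :=
      mul_le_mul_of_nonneg_left (by linarith) hSt.le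
    have m3 := mul_nonneg hSp0 (hV xs (x t))
    refine aux_scalar (R t) M Md C (lam t) (S t) (5 / 2 * Md) hM0 hMd0 hC2 (hlam0 t ht) hSt
      ?_ ?_ (by positivity) le_rfl ?_
    · have := hlamS t ht
      simp only [hSdef]
      rw [this]; field_simp
    · simp only [hRdef]; linarith
    · simp only [hRdef]; linarith
  have htel : ∀ n, ∑ t ∈ Finset.Icc 1 n, R t
      = ∑ t ∈ Finset.Icc 1 n, (φ t (x t) - φ t xs) + S n * breg h xs (x (n + 1)) := by
    intro n
    induction n with
    | zero => simp [hSdef]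
    | succ n ih =>
      rw [Finset.sum_Icc_succ_top (by omega), Finset.sum_Icc_succ_top (by omega), ih]
      simp only [hRdef, Nat.add_sub_cancel]
      ring
  have hcmp := (aux_compare (T + TJ) μ lam ls (fun t => R t / C) (2 * M ^ 2 / C) (by positivity)
    hlam0 hls hpos hSs hlamS
    (fun t ht => by
      have := (hR t ht).1
      rw [div_le_iff₀ hCpos]; linarith)
    (fun t ht => by
      have := (hR t ht).2
      rw [div_le_iff₀ hCpos]; simp only [hSdef] at this; linarith) (T + TJ) le_rfl).2
  rw [← Finset.sum_div, div_le_iff₀ hCpos, htel] at hcmp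
  have hlast : 0 ≤ S (T + TJ) * breg h xs (x (T + TJ + 1)) :=
    mul_nonneg (hpos (T + TJ) (by simp; omega)).le (hV _ _)
  have hsum : (∑ t ∈ Finset.Icc 1 (T + TJ), 2 * M ^ 2 / C /
        ((∑ s ∈ Finset.Icc 1 t, μ s) + ∑ s ∈ Finset.Icc 1 t, ls s)) * C
      ≤ 2 * ∑ t ∈ Finset.Icc 1 (T + TJ), (M + ls t * Md) ^ 2 /
        ((∑ s ∈ Finset.Icc 1 t, μ s) + ∑ s ∈ Finset.Icc 1 t, ls s) := by
    rw [Finset.sum_mul, Finset.mul_sum]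
    apply Finset.sum_le_sum
    intro t ht
    have h1 := hSs t ht
    have h2 := mul_nonneg (hls t ht) hMd0.le
    set Z := (∑ s ∈ Finset.Icc 1 t, μ s) + ∑ s ∈ Finset.Icc 1 t, ls s
    have e : 2 * M ^ 2 / C / Z * C = 2 * (M ^ 2 / Z) := by field_simp
    rw [e]
    have : M ^ 2 / Z ≤ (M + ls t * Md) ^ 2 / Z := by
      apply div_le_div_of_nonneg_right _ h1.le
      nlinarith
    linarith
  rw [add_mul] at hcmp
  linarith
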